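/- Let α_1 > α_2 > … > α_N ≥ 1 and m_1, …, m_N ≥ 1; set m̃_r := m_r if α_r is odd and m̃_r := 2m_r if α_r is even, and n := Σ_r α_r m̃_r. Let 𝒦_0 := ⊕_{r=1}^{N} (⊕_{j=1}^{m_r} K̃_r), where K̃_r := K_{α_r}(0) if α_r is even and K̃_r := L_{α_r} if α_r is odd (an n×n skew-symmetric matrix). Define B_r := ⊕_{j=1}^{m_r} [[0,−1],[1,0]] (a 2m_r × 2m_r skew-symmetric matrix) if α_r is even, and B_r := (−1)^{(α_r−1)/2} I_{m_r} if α_r is odd; set 𝓑 := ⊕_{r=1}^{N} (⊕_{j=1}^{α_r} (−1)^{j−1} B_r) and 𝓕 := ⊕_{r=1}^{N} E_{α_r}(I_{m̃_r}). Then there exists Ψ ∈ GL_n(ℂ) such that the map Q ↦ Ψ Q Ψ^{-1} is a bijection (hence a group isomorphism) from Σ_{𝒦_0} := {Q ∈ M_n(ℂ) : QᵀQ = I and Qᵀ 𝒦_0 Q = 𝒦_0} onto 𝕏 := {𝒳 ∈ 𝕋^{α,μ̃} : 𝓕 𝒳ᵀ 𝓕 𝓑 𝒳 = 𝓑}, where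 𝕋^{α,μ̃} is the block-Toeplitz pattern group formed with the multiplicities m̃_1, …, m̃_N. -/

import Mathlib

open Matrix Complex

noncomputable section

/-- The `m × m` matrix `M_m` with `1/2` on the first superdiagonal and `-1/2` on the
first subdiagonal. -/
def Mmat (m : ℕ) : Matrix (Fin m) (Fin m) ℂ :=
  Matrix.of fun j k =>
    if (k : ℕ) = (j : ℕ) + 1 then (1 : ℂ) / 2
    else if (j : ℕ) = (k : ℕ) + 1 then -(1 / 2) else 0

/-- The `m × m` matrix `N_m(λ)`. -/
def Nmat (m : ℕ) (lam : ℂ) : Matrix (Fin m) (Fin m) ℂ :=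
  Matrix.of fun j k =>
    if (j : ℕ) + (k : ℕ) + 2 = m + 1 then Complex.I * lam
    else if (j : ℕ) + (k : ℕ) + 2 = m ∨ (j : ℕ) + (k : ℕ) + 2 = m + 2 then Complex.I / 2
    else 0

/-- The `2m × 2m` skew-symmetric matrix `K_m(λ) = [[M_m, N_m(λ)], [-N_m(λ), -M_m]]`. -/
def Kmat (m : ℕ) (lam : ℂ) : Matrix (Fin m ⊕ Fin m) (Fin m ⊕ Fin m) ℂ :=
  Matrix.fromBlocks (Mmat m) (Nmat m lam) (-Nmat m lam) (-Mmat m)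

/-- `K_m(λ)` reindexed to have index type `Fin (m + m)`. -/
def KmatFin (m : ℕ) (lam : ℂ) : Matrix (Fin (m + m)) (Fin (m + m)) ℂ :=
  Matrix.reindex finSumFinEquiv finSumFinEquiv (Kmat m lam)

/-- The skew-symmetric matrix `L_a` of odd size `a = 2m-1`, `L_a = (1/2)(T + iS)`. -/
def Lmat (a : ℕ) : Matrix (Fin a) (Fin a) ℂ :=
  Matrix.of fun j k =>
    (1 / 2 : ℂ) *
      ((if (k : ℕ) = (j : ℕ) + 1 then (if (j : ℕ) + 2 ≤ (a + 1) / 2 then 1 else -1)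
        else if (j : ℕ) = (k : ℕ) + 1 then (if (k : ℕ) + 2 ≤ (a + 1) / 2 then -1 else 1)
        else 0)
      + Complex.I *
        (if (j : ℕ) + (k : ℕ) + 2 = a ∨ (j : ℕ) + (k : ℕ) = a then
          (if (j : ℕ) < (k : ℕ) then 1 else if (k : ℕ) < (j : ℕ) then -1 else 0)
        else 0))

/-- The size of the block `K̃_r`: `2α_r` if `α_r` is even, `α_r` if `α_r` is odd. -/
def sizeK (a : ℕ) : ℕ := if Even a then a + a else a

/-- `K̃_r`: equal to `K_{α_r}(0)` if `α_r` is even and to `L_{α_r}` if `α_r` is odd. -/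
def Ktil (a : ℕ) : Matrix (Fin (sizeK a)) (Fin (sizeK a)) ℂ :=
  if h : Even a then
    Matrix.reindex (finCongr (by simp [sizeK, h])) (finCongr (by simp [sizeK, h])) (KmatFin a 0)
  else
    Matrix.reindex (finCongr (by simp [sizeK, h])) (finCongr (by simp [sizeK, h])) (Lmat a)

/-- `𝒦_0 = ⊕_{r=1}^{N} (⊕_{j=1}^{m_r} K̃_r)`. -/
def KK0 (N : ℕ) (α m : Fin N → ℕ) :
    Matrix ((r : Fin N) × (_j : Fin (m r)) × Fin (sizeK (α r)))
      ((r : Fin N) × (_j : Fin (m r)) × Fin (sizeK (α r))) ℂ :=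
  Matrix.blockDiagonal' fun r =>
    Matrix.blockDiagonal' fun _ : Fin (m r) => Ktil (α r)

/-- The modified multiplicities: `m̃_r = m_r` if `α_r` is odd, `m̃_r = 2m_r` if `α_r` is even. -/
def mtil (N : ℕ) (α m : Fin N → ℕ) (r : Fin N) : ℕ := if Even (α r) then 2 * m r else m r

/-- The block-Toeplitz pattern for multiplicities `μ`. -/
def BlockToeplitz (N : ℕ) (α μ : Fin N → ℕ)
    (X : Matrix ((r : Fin N) × (Fin (α r) × Fin (μ r)))
      ((r : Fin N) × (Fin (α r) × Fin (μ r))) ℂ) : Prop :=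
  (∀ (r s : Fin N) (i i' : Fin (α r)) (j j' : Fin (α s)) (p : Fin (μ r)) (q : Fin (μ s)),
      (i' : ℕ) = (i : ℕ) + 1 → (j' : ℕ) = (j : ℕ) + 1 →
      X ⟨r, i', p⟩ ⟨s, j', q⟩ = X ⟨r, i, p⟩ ⟨s, j, q⟩) ∧
  (∀ (r s : Fin N) (i : Fin (α r)) (j : Fin (α s)) (p : Fin (μ r)) (q : Fin (μ s)),
      (i : ℕ) ≠ 0 → (j : ℕ) = 0 → X ⟨r, i, p⟩ ⟨s, j, q⟩ = 0) ∧
  (∀ (r s : Fin N) (i : Fin (α r)) (j : Fin (α s)) (p : Fin (μ r)) (q : Fin (μ s)),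
      (i : ℕ) + 1 = α r → (j : ℕ) + 1 < α s → X ⟨r, i, p⟩ ⟨s, j, q⟩ = 0)

/-- The `(p,q)` entry (0-based) of the matrix `B_r`: for `α_r` even,
`B_r = ⊕_{j=1}^{m_r} [[0,-1],[1,0]]`; for `α_r` odd, `B_r = (-1)^{(α_r-1)/2} I`. -/
def BrEntry (a p q : ℕ) : ℂ :=
  if Even a then
    (if q = p + 1 ∧ Even p then -1 else if p = q + 1 ∧ Even q then 1 else 0)
  else ((-1) ^ ((a - 1) / 2) * if p = q then 1 else 0)

/-- `𝓑 = ⊕_{r=1}^{N} (⊕_{j=1}^{α_r} (-1)^{j-1} B_r)`. -/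
def Bcal (N : ℕ) (α m : Fin N → ℕ) :
    Matrix ((r : Fin N) × (Fin (α r) × Fin (mtil N α m r)))
      ((r : Fin N) × (Fin (α r) × Fin (mtil N α m r))) ℂ :=
  Matrix.of fun x y =>
    if x.1 = y.1 ∧ (x.2.1 : ℕ) = (y.2.1 : ℕ) then
      (-1 : ℂ) ^ (x.2.1 : ℕ) * BrEntry (α x.1) (x.2.2 : ℕ) (y.2.2 : ℕ)
    else 0

/-- `𝓕 = ⊕_{r=1}^{N} E_{α_r}(I_{m̃_r})`. -/
def Fcal (N : ℕ) (α μ : Fin N → ℕ) :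
    Matrix ((r : Fin N) × (Fin (α r) × Fin (μ r)))
      ((r : Fin N) × (Fin (α r) × Fin (μ r))) ℂ :=
  Matrix.of fun x y =>
    if x.1 = y.1 ∧ (x.2.1 : ℕ) + (y.2.1 : ℕ) + 1 = α x.1 ∧ (x.2.2 : ℕ) = (y.2.2 : ℕ) then 1
    else 0

def sg (h i : ℕ) : ℂ := (-1) ^ (i - h)

/-- Odd core change of basis. -/
def Wodd (h : ℕ) : Matrix (Fin (2 * h + 1)) (Fin (2 * h + 1)) ℂ :=
  Matrix.of fun i k => ((1 - Complex.I) / 2 * sg h i) *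
    ((if k = i then 1 else 0) + Complex.I * (if k = i.rev then 1 else 0))

def Uodd (a : ℕ) : Matrix (Fin a) (Fin a) ℂ :=
  Matrix.of fun i k => if (k : ℕ) = (i : ℕ) + 1 then 1 else 0

def Godd (h : ℕ) : Matrix (Fin (2 * h + 1)) (Fin (2 * h + 1)) ℂ :=
  Matrix.of fun i k => if k = i.rev then (-1) ^ (k : ℕ) * (-1) ^ h else 0

lemma sg_mul (h : ℕ) (i : Fin (2 * h + 1)) :
    sg h i * sg h (i.rev : Fin (2 * h + 1)) * ((-1) ^ (i : ℕ) * (-1) ^ h) = 1 := by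
  unfold sg
  rw [Fin.val_rev, ← pow_add, ← pow_add, ← pow_add]
  apply Even.neg_one_pow
  rcases le_total (i : ℕ) h with hi | hi
  · obtain ⟨d, hd⟩ := Nat.exists_eq_add_of_le hi
    refine ⟨(i : ℕ) + d, ?_⟩
    omega
  · obtain ⟨d, hd⟩ := Nat.exists_eq_add_of_le hi
    refine ⟨h + d, ?_⟩
    omega

lemma Wodd_G (h : ℕ) : (Wodd h)ᵀ * Godd h * Wodd h = 1 := by
  have hI := Complex.I_mul_I
  ext k l
  rw [Matrix.mul_assoc, Matrix.mul_apply]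
  have e1 : ∀ i : Fin (2 * h + 1), (Godd h * Wodd h) i l =
      (-1) ^ (i.rev : ℕ) * (-1) ^ h * Wodd h i.rev l := by
    intro i
    simp [Matrix.mul_apply, Godd]
  simp only [e1]
  have e2 : ∀ i : Fin (2 * h + 1), (Wodd h)ᵀ k i * ((-1) ^ (i.rev : ℕ) * (-1) ^ h * Wodd h i.rev l)
      = (-Complex.I / 2) * (((if k = i then 1 else 0) + Complex.I * (if k = i.rev then 1 else 0)) *
       ((if l = i.rev then 1 else 0) + Complex.I * (if l = i then 1 else 0))) := by
    intro i
    have h1 := sg_mul h i.rev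
    rw [Fin.rev_rev] at h1
    simp only [Wodd, Matrix.transpose_apply, Matrix.of_apply, Fin.rev_rev]
    have : ((1 - Complex.I) / 2) * ((1 - Complex.I) / 2) = -Complex.I / 2 := by
      linear_combination (1/4) * hI
    rw [← this]
    linear_combination ((1 - Complex.I) / 2) * ((1 - Complex.I) / 2) * (((if k = i then 1 else 0) + Complex.I * (if k = i.rev then 1 else 0)) *
       ((if l = i.rev then 1 else 0) + Complex.I * (if l = i then 1 else 0))) * h1
  simp only [e2, ← Finset.mul_sum]
  have r1 : ∀ i : Fin (2 * h + 1), (k = i.rev) = (i = k.rev) := fun i => by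
    rw [eq_iff_iff]; constructor <;> (rintro rfl; simp)
  have r2 : ∀ i : Fin (2 * h + 1), (l = i.rev) = (i = l.rev) := fun i => by
    rw [eq_iff_iff]; constructor <;> (rintro rfl; simp)
  have r3 : (k = l.rev) = (k.rev = l) := by
    rw [eq_iff_iff]; constructor <;> (rintro rfl; simp)
  simp only [add_mul, Finset.sum_add_distrib, mul_assoc, ← Finset.mul_sum, ite_mul, zero_mul, one_mul, Finset.sum_ite_eq, Finset.mem_univ, if_true, r1, Finset.sum_ite_eq', Matrix.one_apply, Fin.rev_rev]
  have r4 : (l = k.rev) = (k.rev = l) := by rw [eq_iff_iff]; exact eq_comm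
  have r5 : (l = k) = (k = l) := by rw [eq_iff_iff]; exact eq_comm
  simp only [r4, r5]
  split_ifs <;> grind

set_option maxHeartbeats 4000000 in
lemma Lmat_key (h : ℕ) (i k : Fin (2 * h + 1)) :
    sg h i * (Lmat (2 * h + 1) i k + Complex.I * Lmat (2 * h + 1) i.rev k) =
      if hi : (i : ℕ) + 1 < 2 * h + 1 then
        sg h (i + 1) * ((if (k : ℕ) = (i : ℕ) + 1 then 1 else 0) + Complex.I * (if (k : ℕ) + i + 1 = 2 * h then 1 else 0))
      else 0 := by
  have hI := Complex.I_mul_I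
  have e0 : (2 * h + 1 + 1) / 2 = h + 1 := by omega
  have e1 : ((i.rev : Fin (2 * h + 1)) : ℕ) = 2 * h - i := by rw [Fin.val_rev]; omega
  simp only [Lmat, Matrix.of_apply, e0, e1]
  obtain ⟨i, hi⟩ := i
  obtain ⟨k, hk⟩ := k
  dsimp only
  have c1 : (i + k + 2 = 2 * h + 1) = (k + i + 1 = 2 * h) := by rw [eq_iff_iff]; omega
  have c2 : (i + k = 2 * h + 1) = (k + i = 2 * h + 1) := by rw [eq_iff_iff]; omega
  have c3 : (k = 2 * h - i + 1) = (k + i = 2 * h + 1) := by rw [eq_iff_iff]; omega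
  have c4 : (2 * h - i = k + 1) = (k + i + 1 = 2 * h) := by rw [eq_iff_iff]; omega
  have c5 : (2 * h - i + k + 2 = 2 * h + 1) = (i = k + 1) := by rw [eq_iff_iff]; omega
  have c6 : (2 * h - i + k = 2 * h + 1) = (k = i + 1) := by rw [eq_iff_iff]; omega
  simp only [c1, c2, c3, c4, c5, c6]
  have s : (i < h ∧ sg h i = 1 ∧ sg h (i + 1) = 1) ∨ (h ≤ i ∧ sg h (i + 1) = - sg h i) := by
    rcases lt_or_ge i h with hih | hih
    · left
      refine ⟨hih, ?_, ?_⟩ <;> (unfold sg; rw [Nat.sub_eq_zero_of_le (by omega)]; simp)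
    · right
      refine ⟨hih, ?_⟩
      unfold sg; rw [Nat.sub_add_comm hih, pow_succ]; ring
  clear c1 c2 c3 c4 c5 c6 e0 e1
  by_cases A : k = i + 1
  all_goals by_cases B : i = k + 1
  all_goals try (exfalso; omega)
  all_goals by_cases C : k + i + 1 = 2 * h
  all_goals try (exfalso; omega)
  all_goals by_cases D : k + i = 2 * h + 1
  all_goals try (exfalso; omega)
  all_goals by_cases E1 : i + 2 ≤ h + 1
  all_goals try (exfalso; omega)
  all_goals by_cases E2 : k + 2 ≤ h + 1
  all_goals try (exfalso; omega)
  all_goals by_cases E3 : i < k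
  all_goals try (exfalso; omega)
  all_goals by_cases E4 : k < i
  all_goals try (exfalso; omega)
  all_goals by_cases E5 : 2 * h - i + 2 ≤ h + 1
  all_goals try (exfalso; omega)
  all_goals by_cases E6 : 2 * h - i < k
  all_goals try (exfalso; omega)
  all_goals by_cases E7 : k < 2 * h - i
  all_goals try (exfalso; omega)
  all_goals by_cases E8 : i + 1 < 2 * h + 1
  all_goals try (exfalso; omega)
  all_goals rcases s with ⟨hih, s1, s2⟩ | ⟨hih, s2⟩
  all_goals try (exfalso; omega)
  all_goals try rw [s1]
  all_goals rw [s2]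
  all_goals split_ifs
  all_goals first | (exfalso; omega) | (clear A B C D E1 E2 E3 E4 E5 E6 E7 E8; grind) | grind

lemma Wodd_L (h : ℕ) : Wodd h * Lmat (2 * h + 1) = Uodd (2 * h + 1) * Wodd h := by
  ext i k
  have e1 : (Wodd h * Lmat (2 * h + 1)) i k = (1 - Complex.I) / 2 *
      (sg h i * (Lmat (2 * h + 1) i k + Complex.I * Lmat (2 * h + 1) i.rev k)) := by
    simp only [Matrix.mul_apply, Wodd, Matrix.of_apply, mul_assoc, add_mul, ← Finset.mul_sum,
      Finset.sum_add_distrib, ite_mul, one_mul, zero_mul, Finset.sum_ite_eq', Finset.mem_univ, if_true]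
  rw [e1, Lmat_key, Matrix.mul_apply]
  simp only [Uodd, Matrix.of_apply, ite_mul, one_mul, zero_mul]
  by_cases hi : (i : ℕ) + 1 < 2 * h + 1
  on_goal 1 => rw [dif_pos hi]
  on_goal 2 => rw [dif_neg hi]
  · rw [Finset.sum_eq_single (⟨i + 1, hi⟩ : Fin (2 * h + 1))]
    · simp only [if_true, Wodd, Matrix.of_apply, Fin.ext_iff, Fin.val_rev, mul_assoc]
      have : ((k : ℕ) + i + 1 = 2 * h) = ((k : ℕ) = 2 * h + 1 - (i + 1 + 1)) := by
        rw [eq_iff_iff]; omega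
      simp only [this]
    · intro b _ hb
      rw [if_neg]
      intro h; exact hb (Fin.ext h)
    · simp
  · rw [Finset.sum_eq_zero]
    · simp
    · intro b _
      rw [if_neg]
      have := b.2; omega

/-- Data carrying the pair (identity form, `K`) to (`G`, `J`). -/
def Good {n n' : Type*} [Fintype n] [Fintype n'] [DecidableEq n] (K : Matrix n n ℂ)
    (G J : Matrix n' n' ℂ) : Prop :=
  ∃ W : Matrix n' n ℂ, Wᵀ * G * W = 1 ∧ W * K = J * W

lemma Good.of_submatrix {n n' p p' : Type*} [Fintype n] [Fintype n'] [DecidableEq n]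
    [Fintype p] [Fintype p'] [DecidableEq p] {K : Matrix n n ℂ}
    {G J : Matrix n' n' ℂ} (h : p ≃ n) (g : p' ≃ n')
    (H : Good (K.submatrix h h) (G.submatrix g g) (J.submatrix g g)) : Good K G J := by
  obtain ⟨W, h1, h2⟩ := H
  refine ⟨W.submatrix g.symm h.symm, ?_, ?_⟩
  · have := congrArg (fun A => A.submatrix h.symm h.symm) h1
    simp only [Matrix.submatrix_one_equiv] at this
    rw [← this, ← Matrix.submatrix_mul_equiv _ _ _ g.symm, ← Matrix.submatrix_mul_equiv _ _ _ g.symm]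
    simp [Matrix.submatrix_submatrix, Matrix.transpose_submatrix]
  · have := congrArg (fun A => A.submatrix g.symm h.symm) h2
    rw [← Matrix.submatrix_mul_equiv _ _ _ h.symm, ← Matrix.submatrix_mul_equiv _ _ _ g.symm] at this
    simpa [Matrix.submatrix_submatrix] using this

open scoped Kronecker in
lemma Good.kron {n n' : Type*} [Fintype n] [Fintype n'] [DecidableEq n] {K : Matrix n n ℂ}
    {G J : Matrix n' n' ℂ} (m : ℕ) (H : Good K G J) :
    Good (K ⊗ₖ (1 : Matrix (Fin m) (Fin m) ℂ)) (G ⊗ₖ (1 : Matrix (Fin m) (Fin m) ℂ))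
      (J ⊗ₖ (1 : Matrix (Fin m) (Fin m) ℂ)) := by
  obtain ⟨W, h1, h2⟩ := H
  refine ⟨W ⊗ₖ (1 : Matrix (Fin m) (Fin m) ℂ), ?_, ?_⟩
  · rw [← Matrix.kroneckerMap_transpose, ← Matrix.mul_kronecker_mul, ← Matrix.mul_kronecker_mul, h1]
    simp
  · rw [← Matrix.mul_kronecker_mul, ← Matrix.mul_kronecker_mul, h2]

lemma Good.blockDiagonal' {N : ℕ} {n n' : Fin N → Type*} [∀ r, Fintype (n r)]
    [∀ r, Fintype (n' r)] [∀ r, DecidableEq (n r)] [∀ r, DecidableEq (n' r)]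
    {K : ∀ r, Matrix (n r) (n r) ℂ}
    {G J : ∀ r, Matrix (n' r) (n' r) ℂ} (H : ∀ r, Good (K r) (G r) (J r)) :
    Good (Matrix.blockDiagonal' K) (Matrix.blockDiagonal' G) (Matrix.blockDiagonal' J) := by
  choose W h1 h2 using H
  refine ⟨Matrix.blockDiagonal' W, ?_, ?_⟩
  · rw [Matrix.blockDiagonal'_transpose, ← Matrix.blockDiagonal'_mul, ← Matrix.blockDiagonal'_mul]
    simp only [h1]
    exact Matrix.blockDiagonal'_one
  · rw [← Matrix.blockDiagonal'_mul, ← Matrix.blockDiagonal'_mul]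
    simp only [h2]

def Eflip (a : ℕ) : Matrix (Fin a) (Fin a) ℂ :=
  Matrix.of fun i k => if k = i.rev then 1 else 0

def Dsgn (a : ℕ) : Matrix (Fin a) (Fin a) ℂ := Matrix.diagonal fun i => (-1) ^ (i : ℕ)

lemma Eflip_mul {a : ℕ} (A : Matrix (Fin a) (Fin a) ℂ) (i k) :
    (Eflip a * A) i k = A i.rev k := by
  simp [Matrix.mul_apply, Eflip]

lemma mul_Eflip {a : ℕ} (A : Matrix (Fin a) (Fin a) ℂ) (i k) :
    (A * Eflip a) i k = A i k.rev := by
  have : ∀ j : Fin a, (k = j.rev) = (j = k.rev) := fun i => by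
    rw [eq_iff_iff]; constructor <;> (rintro rfl; simp)
  simp [Matrix.mul_apply, Eflip, this]

lemma good_even (a : ℕ) (ha : Even a) :
    Good (Kmat a 0) (Matrix.fromBlocks 0 (-(Eflip a * Dsgn a)) (Eflip a * Dsgn a) 0)
      (Matrix.fromBlocks (Uodd a) 0 0 (Uodd a)) := by
  obtain ⟨s, hs⟩ := IsAlgClosed.exists_eq_mul_self (1 / 2 : ℂ)
  have hI := Complex.I_mul_I
  set E := Eflip a with hE
  set D := Dsgn a with hD
  set U := Uodd a with hU
  set V := Uᵀ with hV
  have EE : E * E = 1 := by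
    ext i k; rw [hE, Eflip_mul]; simp [Eflip, Matrix.one_apply, eq_comm]
  have DD : D * D = 1 := by
    rw [hD, Dsgn, Matrix.diagonal_mul_diagonal, ← Matrix.diagonal_one]
    congr 1; ext i; rw [← pow_add]; exact Even.neg_one_pow ⟨_, rfl⟩
  have ET : Eᵀ = E := by
    ext i k; simp only [hE, Eflip, Matrix.transpose_apply, Matrix.of_apply]
    congr 1; rw [eq_iff_iff]; constructor <;> (rintro rfl; simp)
  have DT : Dᵀ = D := by simp [hD, Dsgn]
  have ED : E * D = -(D * E) := by
    ext i k; rw [hE, Eflip_mul, Matrix.neg_apply, mul_Eflip, hD]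
    simp only [Dsgn, Matrix.diagonal_apply]
    have : (i.rev = k) = (i = k.rev) := by
      rw [eq_iff_iff]; constructor <;> (rintro rfl; simp)
    simp only [this]
    split_ifs with h
    · subst h
      rw [Fin.rev_rev]
      obtain ⟨b, hb⟩ := ha
      rcases Nat.even_or_odd (k : ℕ) with h | h
      · have : Odd ((k.rev : Fin a) : ℕ) := by
          rw [Fin.val_rev]; obtain ⟨c, hc⟩ := h; have := k.2; exact ⟨b - c - 1, by omega⟩
        rw [h.neg_one_pow, this.neg_one_pow]; simp
      · have : Even ((k.rev : Fin a) : ℕ) := by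
          rw [Fin.val_rev]; obtain ⟨c, hc⟩ := h; have := k.2; exact ⟨b - c - 1, by omega⟩
        rw [h.neg_one_pow, this.neg_one_pow]
    · simp
  have UD : U * D = -(D * U) := by
    ext i k
    rw [hD, Dsgn, Matrix.neg_apply, Matrix.mul_diagonal, Matrix.diagonal_mul]
    simp only [hU, Uodd, Matrix.of_apply]
    split_ifs with h
    · rw [h, pow_succ]; ring
    · simp
  have EU : E * U = V * E := by
    ext i k; rw [hE, Eflip_mul, mul_Eflip]
    simp only [hV, hU, Uodd, Matrix.transpose_apply, Matrix.of_apply, Fin.val_rev]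
    congr 1; rw [eq_iff_iff]; omega
  have EV : E * V = U * E := by
    have h1 : V * E = E * U := EU.symm
    calc E * V = E * (V * E) * E := by rw [mul_assoc, mul_assoc, EE, mul_one]
      _ = U * E := by rw [h1, ← mul_assoc, EE, one_mul]
  have hM : Mmat a = (1 / 2 : ℂ) • (U - V) := by
    ext i k
    simp only [Mmat, hV, hU, Uodd, Matrix.of_apply, Matrix.smul_apply, Matrix.sub_apply,
      Matrix.transpose_apply, smul_eq_mul]
    split_ifs <;> first | (exfalso; omega) | norm_num
  have hN : Nmat a 0 = (Complex.I / 2 : ℂ) • ((U + V) * E) := by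
    ext i k
    rw [Matrix.smul_apply, mul_Eflip]
    simp only [Nmat, hV, hU, Uodd, Matrix.of_apply, Matrix.add_apply,
      Matrix.transpose_apply, smul_eq_mul, Fin.val_rev]
    split_ifs <;> first | (exfalso; omega) | norm_num
  have EU' : ∀ X, E * (U * X) = V * (E * X) := fun X => by rw [← mul_assoc, EU, mul_assoc]
  have EV' : ∀ X, E * (V * X) = U * (E * X) := fun X => by rw [← mul_assoc, EV, mul_assoc]
  have UD' : ∀ X, U * (D * X) = -(D * (U * X)) := fun X => by
    rw [← mul_assoc, UD, neg_mul, mul_assoc]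
  have ED' : ∀ X, E * (D * X) = -(D * (E * X)) := fun X => by
    rw [← mul_assoc, ED, neg_mul, mul_assoc]
  have DD' : ∀ X, D * (D * X) = X := fun X => by rw [← mul_assoc, DD, one_mul]
  have EE' : ∀ X, E * (E * X) = X := fun X => by rw [← mul_assoc, EE, one_mul]
  refine ⟨s • Matrix.fromBlocks 1 (Complex.I • E) (-(D * E)) (Complex.I • D), ?_, ?_⟩
  · rw [Matrix.transpose_smul, Matrix.fromBlocks_transpose]
    simp only [Matrix.smul_mul, Matrix.mul_smul, smul_smul, ← hs]
    simp only [Matrix.fromBlocks_multiply, Matrix.transpose_neg, Matrix.transpose_mul,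
      Matrix.transpose_smul, ET, DT, Matrix.transpose_one, zero_mul, mul_zero, one_mul, mul_one,
      zero_add, add_zero, neg_mul, mul_neg, neg_neg, Matrix.smul_mul, Matrix.mul_smul, smul_smul,
      mul_assoc, ED, ED', DD, DD', EE, EE', smul_neg, hI]
    rw [← Matrix.fromBlocks_one, Matrix.fromBlocks_smul]
    congr 1
    · module
    · module
    · module
    · module
  · rw [Matrix.smul_mul, Matrix.mul_smul]
    congr 1
    rw [Kmat, hM, hN]
    simp only [Matrix.fromBlocks_multiply, zero_mul, mul_zero, one_mul, mul_one,
      zero_add, add_zero, neg_mul, mul_neg, neg_neg, Matrix.smul_mul, Matrix.mul_smul, smul_smul,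
      mul_add, mul_sub, add_mul, sub_mul,
      mul_assoc, ED, ED', DD, DD', EE, EE', UD, UD', EU, EU', EV, EV', smul_neg, hI]
    have h2 : Complex.I * (Complex.I / 2) = -(1/2) := by linear_combination (1/2) * hI
    congr 1
    all_goals match_scalars <;> grind

def Gblk (a mt : ℕ) : Matrix (Fin a × Fin mt) (Fin a × Fin mt) ℂ :=
  Matrix.of fun x y => if y.1 = x.1.rev then (-1) ^ (y.1 : ℕ) * BrEntry a x.2 y.2 else 0

def Jblk (a mt : ℕ) : Matrix (Fin a × Fin mt) (Fin a × Fin mt) ℂ :=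
  Matrix.of fun x y => if (y.1 : ℕ) = (x.1 : ℕ) + 1 ∧ x.2 = y.2 then 1 else 0

/-- index equivalence for the source of one block -/
def hEquiv {A : Type*} {n : ℕ} (m : ℕ) (f : A ≃ Fin n) : A × Fin m ≃ (_j : Fin m) × Fin n where
  toFun x := ⟨x.2, f x.1⟩
  invFun y := (f.symm y.2, y.1)
  left_inv x := by simp
  right_inv y := by simp

open scoped Kronecker in
lemma blk_kron {A : Type*} [Fintype A] [DecidableEq A] {n : ℕ} (m : ℕ) (f : A ≃ Fin n)
    (K : Matrix (Fin n) (Fin n) ℂ) :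
    (Matrix.blockDiagonal' fun _ : Fin m => K).submatrix (hEquiv m f) (hEquiv m f)
      = (K.submatrix f f) ⊗ₖ (1 : Matrix (Fin m) (Fin m) ℂ) := by
  ext ⟨x, j⟩ ⟨y, k⟩
  simp only [Matrix.submatrix_apply, hEquiv, Equiv.coe_fn_mk, Matrix.kroneckerMap_apply,
    Matrix.one_apply, Matrix.blockDiagonal'_apply]
  by_cases h : j = k
  · subst h; simp
  · simp [h]

def gEquiv (a m : ℕ) : (Fin a ⊕ Fin a) × Fin m ≃ Fin a × Fin (2 * m) where
  toFun x := (Sum.elim id id x.1, ⟨2 * (x.2 : ℕ) + Sum.elim (fun _ => 0) (fun _ => 1) x.1, by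
    obtain ⟨x | x, j⟩ := x <;> simp <;> omega⟩)
  invFun y := (if (y.2 : ℕ) % 2 = 0 then Sum.inl y.1 else Sum.inr y.1, ⟨(y.2 : ℕ) / 2, by omega⟩)
  left_inv x := by
    obtain ⟨x | x, j⟩ := x
    · simp
    · simp [Fin.ext_iff, Nat.add_mod]; omega
  right_inv y := by
    obtain ⟨i, p⟩ := y
    rcases Nat.mod_two_eq_zero_or_one (p : ℕ) with h | h
    · simp [h, Fin.ext_iff]; omega
    · simp [h, Fin.ext_iff]; omega

lemma Br00 (a j k : ℕ) (ha : Even a) : BrEntry a (2 * j + 0) (2 * k + 0) = 0 := by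
  rw [BrEntry, if_pos ha, if_neg (by omega), if_neg (by omega)]

lemma Br11 (a j k : ℕ) (ha : Even a) : BrEntry a (2 * j + 1) (2 * k + 1) = 0 := by
  rw [BrEntry, if_pos ha, if_neg (by omega), if_neg (by omega)]

lemma Br01 (a j k : ℕ) (ha : Even a) :
    BrEntry a (2 * j + 0) (2 * k + 1) = if j = k then -1 else 0 := by
  rw [BrEntry, if_pos ha]
  by_cases h : j = k
  · rw [if_pos ⟨by omega, by simp⟩, if_pos h]
  · rw [if_neg (by omega), if_neg, if_neg h]
    rintro ⟨h1, h2⟩; rw [Nat.even_iff] at h2; omega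

lemma Br10 (a j k : ℕ) (ha : Even a) :
    BrEntry a (2 * j + 1) (2 * k + 0) = if j = k then 1 else 0 := by
  rw [BrEntry, if_pos ha]
  by_cases h : j = k
  · rw [if_neg (by omega), if_pos ⟨by omega, by simp⟩, if_pos h]
  · rw [if_neg, if_neg (by omega), if_neg h]
    rintro ⟨h1, h2⟩; rw [Nat.even_iff] at h2; omega

lemma block_even (a m : ℕ) (ha : Even a) :
    Good (Matrix.blockDiagonal' fun _ : Fin m => Ktil a) (Gblk a (2 * m)) (Jblk a (2 * m)) := by
  have hs : a + a = sizeK a := by simp [sizeK, ha]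
  let f : Fin a ⊕ Fin a ≃ Fin (sizeK a) := finSumFinEquiv.trans (finCongr hs)
  apply Good.of_submatrix (hEquiv m f) (gEquiv a m)
  rw [blk_kron]
  have hK : (Ktil a).submatrix f f = Kmat a 0 := by
    ext x y
    simp [Ktil, ha, KmatFin, f]
  rw [hK]
  convert (good_even a ha).kron m using 1
  · ext ⟨x, j⟩ ⟨y, k⟩
    have ED : ∀ i k : Fin a, (Eflip a * Dsgn a) i k = if k = i.rev then (-1) ^ (k : ℕ) else 0 := by
      intro i k
      rw [Eflip_mul, Dsgn, Matrix.diagonal_apply]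
      by_cases h : k = i.rev
      · subst h; simp
      · rw [if_neg h, if_neg (Ne.symm h)]
    rcases x with x | x <;> rcases y with y | y <;>
      simp only [Matrix.submatrix_apply, gEquiv, Equiv.coe_fn_mk, Matrix.kroneckerMap_apply,
        Matrix.one_apply, Gblk, Matrix.of_apply, Br00 _ _ _ ha, Br01 _ _ _ ha,
        Br10 _ _ _ ha, Br11 _ _ _ ha, Sum.elim_inl, Sum.elim_inr,
        Matrix.fromBlocks_apply₁₁, Matrix.fromBlocks_apply₁₂, Matrix.fromBlocks_apply₂₁,
        Matrix.fromBlocks_apply₂₂, Matrix.zero_apply, Matrix.neg_apply, ED, id, Fin.ext_iff (a := j)]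
    · simp
    · split_ifs <;> simp
    · split_ifs <;> simp
    · simp
  · ext ⟨x, j⟩ ⟨y, k⟩
    rcases x with x | x <;> rcases y with y | y <;>
      simp only [Matrix.submatrix_apply, gEquiv, Equiv.coe_fn_mk, Matrix.kroneckerMap_apply,
        Matrix.one_apply, Jblk, Uodd, Matrix.of_apply, Sum.elim_inl, Sum.elim_inr,
        Matrix.fromBlocks_apply₁₁, Matrix.fromBlocks_apply₁₂, Matrix.fromBlocks_apply₂₁,
        Matrix.fromBlocks_apply₂₂, Matrix.zero_apply, id, Fin.ext_iff]
    · by_cases h : (j : ℕ) = k <;> simp [h]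
    · rw [if_neg (by omega)]; simp
    · rw [if_neg (by omega)]; simp
    · by_cases h : (j : ℕ) = k <;> simp [h]

lemma block_odd (h m : ℕ) :
    Good (Matrix.blockDiagonal' fun _ : Fin m => Ktil (2 * h + 1)) (Gblk (2 * h + 1) m)
      (Jblk (2 * h + 1) m) := by
  have ha : ¬ Even (2 * h + 1) := by simp
  have hs : 2 * h + 1 = sizeK (2 * h + 1) := by rw [sizeK, if_neg ha]
  apply Good.of_submatrix (hEquiv m (finCongr hs)) (Equiv.refl _)
  rw [blk_kron]
  have hK : (Ktil (2 * h + 1)).submatrix (finCongr hs) (finCongr hs) = Lmat (2 * h + 1) := by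
    ext x y
    simp [Ktil]
  rw [hK]
  have : Good (Lmat (2 * h + 1)) (Godd h) (Uodd (2 * h + 1)) := ⟨Wodd h, Wodd_G h, Wodd_L h⟩
  convert this.kron m using 1
  · ext ⟨x, j⟩ ⟨y, k⟩
    have e : (2 * h + 1 - 1) / 2 = h := by omega
    simp only [Matrix.submatrix_apply, Equiv.coe_refl, id, Matrix.kroneckerMap_apply,
        Matrix.one_apply, Gblk, Godd, Matrix.of_apply, BrEntry, if_neg ha, e, Fin.ext_iff (a := j)]
    split_ifs <;> ring
  · ext ⟨x, j⟩ ⟨y, k⟩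
    simp only [Matrix.submatrix_apply, Equiv.coe_refl, id, Matrix.kroneckerMap_apply,
        Matrix.one_apply, Jblk, Uodd, Matrix.of_apply]
    by_cases h : j = k <;> simp [h]

lemma block_odd' (a m : ℕ) (ha : Odd a) :
    Good (Matrix.blockDiagonal' fun _ : Fin m => Ktil a) (Gblk a m) (Jblk a m) := by
  obtain ⟨h, rfl⟩ := ha
  exact block_odd h m

lemma good_all (N : ℕ) (α m : Fin N → ℕ) :
    Good (KK0 N α m) (Matrix.blockDiagonal' fun r => Gblk (α r) (mtil N α m r))
      (Matrix.blockDiagonal' fun r => Jblk (α r) (mtil N α m r)) := by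
  unfold KK0
  apply Good.blockDiagonal'
  intro r
  rcases Nat.even_or_odd (α r) with h | h
  · have : mtil N α m r = 2 * m r := by simp [mtil, h]
    rw [this]
    exact block_even _ _ h
  · have : mtil N α m r = m r := by
      rw [mtil, if_neg]; exact Nat.not_even_iff_odd.mpr h
    rw [this]
    exact block_odd' _ _ h

lemma F_mul (N : ℕ) (α μ : Fin N → ℕ) {κ : Type*} (A : Matrix ((r : Fin N) × (Fin (α r) × Fin (μ r))) κ ℂ)
    (r : Fin N) (i : Fin (α r)) (p : Fin (μ r)) (y : κ) :
    (Fcal N α μ * A) ⟨r, i, p⟩ y = A ⟨r, i.rev, p⟩ y := by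
  rw [Matrix.mul_apply, Finset.sum_eq_single (⟨r, i.rev, p⟩ : (r : Fin N) × (Fin (α r) × Fin (μ r)))]
  · simp only [Fcal, Matrix.of_apply, Fin.val_rev]
    rw [if_pos ⟨trivial, by omega, trivial⟩, one_mul]
  · rintro ⟨s, j, q⟩ _ hne
    simp only [Fcal, Matrix.of_apply]
    rw [if_neg, zero_mul]
    rintro ⟨h1, h2, h3⟩
    subst h1
    apply hne
    have e1 : j = i.rev := by rw [Fin.ext_iff, Fin.val_rev]; omega
    have e2 : q = p := Fin.ext h3.symm
    rw [e1, e2]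
  · simp

lemma F_F (N : ℕ) (α μ : Fin N → ℕ) : Fcal N α μ * Fcal N α μ = 1 := by
  ext ⟨r, i, p⟩ ⟨s, j, q⟩
  rw [F_mul]
  simp only [Fcal, Matrix.of_apply, Matrix.one_apply, Fin.val_rev]
  congr 1
  rw [eq_iff_iff]
  constructor
  · rintro ⟨h1, h2, h3⟩
    subst h1
    have e1 : i = j := by rw [Fin.ext_iff]; omega
    have e2 : p = q := Fin.ext h3
    rw [e1, e2]
  · intro h
    obtain ⟨rfl, h⟩ := Sigma.mk.inj_iff.mp h
    have h' := eq_of_heq h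
    simp only [Prod.mk.injEq] at h'
    obtain ⟨rfl, rfl⟩ := h'
    exact ⟨rfl, by omega, rfl⟩

lemma F_B (N : ℕ) (α m : Fin N → ℕ) : Fcal N α (mtil N α m) * Bcal N α m =
    Matrix.blockDiagonal' fun r => Gblk (α r) (mtil N α m r) := by
  ext ⟨r, i, p⟩ ⟨s, j, q⟩
  rw [F_mul, Matrix.blockDiagonal'_apply]
  simp only [Bcal, Matrix.of_apply]
  by_cases h : r = s
  · subst h
    simp only [true_and, dif_pos, cast_eq, Gblk, Matrix.of_apply, Fin.ext_iff]
    by_cases h : (j : ℕ) = (i.rev : Fin _)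
    · rw [if_pos h, if_pos h.symm, h]
    · rw [if_neg h, if_neg (Ne.symm h)]
  · simp [h]

lemma toeplitz_iff (N : ℕ) (α μ : Fin N → ℕ)
    (X : Matrix ((r : Fin N) × (Fin (α r) × Fin (μ r)))
      ((r : Fin N) × (Fin (α r) × Fin (μ r))) ℂ) :
    BlockToeplitz N α μ X ↔
      X * (Matrix.blockDiagonal' fun r => Jblk (α r) (μ r)) =
        (Matrix.blockDiagonal' fun r => Jblk (α r) (μ r)) * X := by
  set J := (Matrix.blockDiagonal' fun r => Jblk (α r) (μ r)) with hJ
  have Japp : ∀ (r s : Fin N) (i : Fin (α r)) (j : Fin (α s)) p q, J ⟨r, i, p⟩ ⟨s, j, q⟩ =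
      if r = s ∧ (j : ℕ) = (i : ℕ) + 1 ∧ (p : ℕ) = q then 1 else 0 := by
    intro r s i j p q
    rw [hJ, Matrix.blockDiagonal'_apply]
    by_cases h : r = s
    · subst h; simp [Jblk, Fin.ext_iff]
    · simp [h]
  have L1 : ∀ (r : Fin N) (i : Fin (α r)) p y (h : (i : ℕ) + 1 < α r),
      (J * X) ⟨r, i, p⟩ y = X ⟨r, ⟨i + 1, h⟩, p⟩ y := by
    intro r i p y h
    rw [Matrix.mul_apply, Finset.sum_eq_single (⟨r, ⟨i + 1, h⟩, p⟩ : (r : Fin N) × (Fin (α r) × Fin (μ r)))]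
    · simp [Japp]
    · rintro ⟨s, j, q⟩ _ hne
      rw [Japp, if_neg, zero_mul]
      rintro ⟨h1, h2, h3⟩
      subst h1
      apply hne
      rw [show j = ⟨i + 1, h⟩ from Fin.ext h2, show q = p from Fin.ext h3.symm]
    · simp
  have L2 : ∀ (r : Fin N) (i : Fin (α r)) p y (h : (i : ℕ) + 1 = α r),
      (J * X) ⟨r, i, p⟩ y = 0 := by
    intro r i p y h
    rw [Matrix.mul_apply, Finset.sum_eq_zero]
    rintro ⟨s, j, q⟩ _
    rw [Japp, if_neg, zero_mul]
    rintro ⟨h1, h2, h3⟩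
    subst h1
    have := j.2
    omega
  have R1 : ∀ (s : Fin N) (j j' : Fin (α s)) q x (h : (j' : ℕ) = j + 1),
      (X * J) x ⟨s, j', q⟩ = X x ⟨s, j, q⟩ := by
    intro s j j' q x h
    rw [Matrix.mul_apply, Finset.sum_eq_single (⟨s, j, q⟩ : (r : Fin N) × (Fin (α r) × Fin (μ r)))]
    · simp [Japp, h]
    · rintro ⟨r, i, p⟩ _ hne
      rw [Japp, if_neg, mul_zero]
      rintro ⟨h1, h2, h3⟩
      subst h1
      apply hne
      rw [show i = j from Fin.ext (by omega), show p = q from Fin.ext h3]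
    · simp
  have R2 : ∀ (s : Fin N) (j : Fin (α s)) q x (h : (j : ℕ) = 0),
      (X * J) x ⟨s, j, q⟩ = 0 := by
    intro s j q x h
    rw [Matrix.mul_apply, Finset.sum_eq_zero]
    rintro ⟨r, i, p⟩ _
    rw [Japp, if_neg, mul_zero]
    rintro ⟨h1, h2, h3⟩
    omega
  constructor
  · rintro ⟨h1, h2, h3⟩
    ext ⟨r, i, p⟩ ⟨s, j, q⟩
    by_cases hi : (i : ℕ) + 1 < α r
    · rw [L1 r i p _ hi]
      by_cases hj : (j : ℕ) = 0
      · rw [R2 _ _ _ _ hj, h2 _ _ _ _ _ _ (by simp) hj]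
      · rw [R1 s ⟨j - 1, by omega⟩ j q _ (by simp; omega)]
        exact (h1 _ _ _ _ _ _ _ _ (by simp) (by simp; omega)).symm
    · have hi' : (i : ℕ) + 1 = α r := by omega
      rw [L2 r i p _ hi']
      by_cases hj : (j : ℕ) = 0
      · rw [R2 _ _ _ _ hj]
      · rw [R1 s ⟨j - 1, by omega⟩ j q _ (by simp; omega)]
        exact h3 _ _ _ _ _ _ hi' (by simp; omega)
  · intro H
    refine ⟨?_, ?_, ?_⟩
    · intro r s i i' j j' p q hi hj
      have := congrFun (congrFun H ⟨r, i, p⟩) ⟨s, j', q⟩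
      rw [R1 s j j' q _ hj, L1 r i p _ (by omega)] at this
      rw [this]
      congr 3
      exact Fin.ext hi
    · intro r s i j p q hi hj
      have := congrFun (congrFun H ⟨r, ⟨i - 1, by omega⟩, p⟩) ⟨s, j, q⟩
      rw [R2 s j q _ hj, L1 r _ p _ (by simp; omega)] at this
      rw [this]
      congr 3
      exact Fin.ext (by simp; omega)
    · intro r s i j p q hi hj
      have := congrFun (congrFun H ⟨r, i, p⟩) ⟨s, ⟨j + 1, hj⟩, q⟩
      rw [R1 s j _ q _ rfl, L2 r i p _ hi] at this
      exact this

lemma card_eq (N : ℕ) (α m : Fin N → ℕ) :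
    Fintype.card ((r : Fin N) × (_j : Fin (m r)) × Fin (sizeK (α r))) =
      Fintype.card ((r : Fin N) × (Fin (α r) × Fin (mtil N α m r))) := by
  simp only [Fintype.card_sigma, Fintype.card_prod, Fintype.card_fin, Finset.sum_const,
    Finset.card_univ, smul_eq_mul]
  refine Finset.sum_congr rfl fun r _ => ?_
  unfold sizeK mtil
  split_ifs <;> ring

/-- The isotropy group of `𝒦_0` is conjugate (via an invertible `Ψ`,
composed with a relabeling of indices) to
`𝕏 = {𝒳 ∈ 𝕋^{α,μ̃} : 𝓕 𝒳ᵀ 𝓕 𝓑 𝒳 = 𝓑}`. -/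
theorem stmt3 (N : ℕ) (hN : 0 < N) (α m : Fin N → ℕ)
    (hmono : ∀ r s : Fin N, r < s → α s < α r)
    (hα : ∀ r, 0 < α r) (hm : ∀ r, 0 < m r) :
    ∃ (e : ((r : Fin N) × (_j : Fin (m r)) × Fin (sizeK (α r))) ≃
        ((r : Fin N) × (Fin (α r) × Fin (mtil N α m r))))
      (Ψ : Matrix ((r : Fin N) × (Fin (α r) × Fin (mtil N α m r)))
        ((r : Fin N) × (Fin (α r) × Fin (mtil N α m r))) ℂ),
      IsUnit Ψ ∧
      Set.BijOn (fun Q => Ψ * (Matrix.reindex e e Q) * Ψ⁻¹)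
        {Q | Qᵀ * Q = 1 ∧ Qᵀ * KK0 N α m * Q = KK0 N α m}
        {X | (IsUnit X ∧ BlockToeplitz N α (mtil N α m) X) ∧
            Fcal N α (mtil N α m) * Xᵀ * Fcal N α (mtil N α m) * Bcal N α m * X
              = Bcal N α m} := by
  classical
  obtain ⟨W, hW1, hW2⟩ := good_all N α m
  rw [← F_B] at hW1
  set F := Fcal N α (mtil N α m) with hF
  set B := Bcal N α m with hB
  have FF : F * F = 1 := F_F _ _ _
  let e := Fintype.equivOfCardEq (card_eq N α m)
  set Ψ := W.submatrix id e.symm with hΨ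
  set J := Matrix.blockDiagonal' fun r => Jblk (α r) (mtil N α m r) with hJ
  set K := Matrix.reindex e e (KK0 N α m) with hK
  have h1 : Ψᵀ * (F * B) * Ψ = 1 := by
    have := congrArg (fun A => A.submatrix e.symm e.symm) hW1
    simp only [Matrix.submatrix_one_equiv] at this
    rw [← this]
    ext x y
    rfl
  have h2 : Ψ * K = J * Ψ := by
    have := congrArg (fun A => A.submatrix id e.symm) hW2
    rw [hK, Matrix.reindex_apply, hΨ, Matrix.submatrix_mul_equiv]
    rw [this]
    rfl
  have hU : IsUnit Ψ := by
    rw [Matrix.isUnit_iff_isUnit_det]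
    exact Matrix.isUnit_det_of_left_inverse h1
  have hdet := (Matrix.isUnit_iff_isUnit_det Ψ).mp hU
  have i1 : Ψ * Ψ⁻¹ = 1 := Matrix.mul_nonsing_inv _ hdet
  have i2 : Ψ⁻¹ * Ψ = 1 := Matrix.nonsing_inv_mul _ hdet
  have i3 : Ψᵀ * (Ψ⁻¹)ᵀ = 1 := by rw [← Matrix.transpose_mul, i2, Matrix.transpose_one]
  have i4 : (Ψ⁻¹)ᵀ * Ψᵀ = 1 := by rw [← Matrix.transpose_mul, i1, Matrix.transpose_one]
  -- the membership equivalence in reindexed form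
  have key : ∀ Q : Matrix ((r : Fin N) × (Fin (α r) × Fin (mtil N α m r)))
        ((r : Fin N) × (Fin (α r) × Fin (mtil N α m r))) ℂ,
      (Qᵀ * Q = 1 ∧ Qᵀ * K * Q = K) ↔
      ((IsUnit (Ψ * Q * Ψ⁻¹) ∧ BlockToeplitz N α (mtil N α m) (Ψ * Q * Ψ⁻¹)) ∧
        F * (Ψ * Q * Ψ⁻¹)ᵀ * F * B * (Ψ * Q * Ψ⁻¹) = B) := by
    intro Q
    rw [toeplitz_iff, ← hJ]
    have a1 : (Qᵀ * Q = 1) ↔ F * (Ψ * Q * Ψ⁻¹)ᵀ * F * B * (Ψ * Q * Ψ⁻¹) = B := by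
      have c1 : F * (Ψ * Q * Ψ⁻¹)ᵀ * F * B * (Ψ * Q * Ψ⁻¹) =
          F * ((Ψ⁻¹)ᵀ * (Qᵀ * Q) * Ψ⁻¹) := by
        calc _ = F * ((Ψ⁻¹)ᵀ * (Qᵀ * (Ψᵀ * (F * B) * Ψ) * Q) * Ψ⁻¹) := by
              simp only [Matrix.transpose_mul, Matrix.mul_assoc]
          _ = _ := by rw [h1, Matrix.mul_one]
      have c2 : B = F * ((Ψ⁻¹)ᵀ * 1 * Ψ⁻¹) := by
        have : (Ψ⁻¹)ᵀ * (Ψᵀ * (F * B) * Ψ) * Ψ⁻¹ = F * B := by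
          calc _ = ((Ψ⁻¹)ᵀ * Ψᵀ) * (F * B) * (Ψ * Ψ⁻¹) := by simp only [Matrix.mul_assoc]
            _ = _ := by rw [i1, i4, Matrix.one_mul, Matrix.mul_one]
        rw [← h1, this, ← Matrix.mul_assoc, FF, Matrix.one_mul]
      constructor
      · intro h
        rw [c1, h]; exact c2.symm
      · intro h
        rw [c1] at h
        have h' := h.trans c2
        have h3 := congrArg (fun A => Ψᵀ * (F * A) * Ψ) h'
        have c3 : ∀ A, Ψᵀ * (F * (F * ((Ψ⁻¹)ᵀ * A * Ψ⁻¹))) * Ψ = A := by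
          intro A
          calc _ = (Ψᵀ * ((F * F) * (Ψ⁻¹)ᵀ)) * A * (Ψ⁻¹ * Ψ) := by simp only [Matrix.mul_assoc]
            _ = _ := by rw [FF, i2, Matrix.one_mul, i3, Matrix.one_mul, Matrix.mul_one]
        rwa [c3, c3] at h3
    have a2 : (Ψ * Q * Ψ⁻¹ * J = J * (Ψ * Q * Ψ⁻¹)) ↔ Q * K = K * Q := by
      have hJ' : J = Ψ * K * Ψ⁻¹ := by rw [h2, Matrix.mul_assoc, i1, Matrix.mul_one]
      have c1 : Ψ * Q * Ψ⁻¹ * J = Ψ * (Q * K) * Ψ⁻¹ := by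
        calc _ = Ψ * (Q * (Ψ⁻¹ * Ψ) * K) * Ψ⁻¹ := by rw [hJ']; simp only [Matrix.mul_assoc]
          _ = _ := by rw [i2, Matrix.mul_one]
      have c2 : J * (Ψ * Q * Ψ⁻¹) = Ψ * (K * Q) * Ψ⁻¹ := by
        calc _ = Ψ * (K * (Ψ⁻¹ * Ψ) * Q) * Ψ⁻¹ := by rw [hJ']; simp only [Matrix.mul_assoc]
          _ = _ := by rw [i2, Matrix.mul_one]
      rw [c1, c2]
      constructor
      · intro h
        have h3 := congrArg (fun A => Ψ⁻¹ * A * Ψ) h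
        have c3 : ∀ A, Ψ⁻¹ * (Ψ * A * Ψ⁻¹) * Ψ = A := by
          intro A
          calc _ = (Ψ⁻¹ * Ψ) * A * (Ψ⁻¹ * Ψ) := by simp only [Matrix.mul_assoc]
            _ = _ := by rw [i2, Matrix.one_mul, Matrix.mul_one]
        rwa [c3, c3] at h3
      · intro h; rw [h]
    rw [← a1, a2]
    constructor
    · rintro ⟨q1, q2⟩
      have q1' : Q * Qᵀ = 1 := mul_eq_one_comm.mp q1
      refine ⟨⟨?_, ?_⟩, q1⟩
      · have hQ : IsUnit Q := IsUnit.of_mul_eq_one Qᵀ q1'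
        have hi : IsUnit Ψ⁻¹ := IsUnit.of_mul_eq_one Ψ i2
        exact (hU.mul hQ).mul hi
      · calc Q * K = Q * (Qᵀ * K * Q) := by rw [q2]
          _ = (Q * Qᵀ) * (K * Q) := by simp only [Matrix.mul_assoc]
          _ = K * Q := by rw [q1', Matrix.one_mul]
    · rintro ⟨⟨-, q2⟩, q1⟩
      refine ⟨q1, ?_⟩
      rw [Matrix.mul_assoc, ← q2, ← Matrix.mul_assoc, q1, Matrix.one_mul]
  have key2 : ∀ Q, (Qᵀ * Q = 1 ∧ Qᵀ * KK0 N α m * Q = KK0 N α m) ↔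
      ((Matrix.reindex e e Q)ᵀ * (Matrix.reindex e e Q) = 1 ∧
        (Matrix.reindex e e Q)ᵀ * K * (Matrix.reindex e e Q) = K) := by
    intro Q
    have inj := (Matrix.reindex e e (α := ℂ)).injective
    have t1 : (Matrix.reindex e e Q)ᵀ * (Matrix.reindex e e Q) = Matrix.reindex e e (Qᵀ * Q) := by
      simp [Matrix.reindex_apply, Matrix.transpose_submatrix, Matrix.submatrix_mul_equiv]
    have t2 : (Matrix.reindex e e Q)ᵀ * K * (Matrix.reindex e e Q) =
        Matrix.reindex e e (Qᵀ * KK0 N α m * Q) := by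
      simp [hK, Matrix.reindex_apply, Matrix.transpose_submatrix, Matrix.submatrix_mul_equiv]
    have t3 : (1 : Matrix ((r : Fin N) × (Fin (α r) × Fin (mtil N α m r)))
        ((r : Fin N) × (Fin (α r) × Fin (mtil N α m r))) ℂ) = Matrix.reindex e e 1 := by simp
    rw [t1, t2, t3, hK, inj.eq_iff, inj.eq_iff]
  have c3 : ∀ A, Ψ⁻¹ * (Ψ * A * Ψ⁻¹) * Ψ = A := by
    intro A
    calc _ = (Ψ⁻¹ * Ψ) * A * (Ψ⁻¹ * Ψ) := by simp only [Matrix.mul_assoc]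
      _ = _ := by rw [i2, Matrix.one_mul, Matrix.mul_one]
  have c4 : ∀ A, Ψ * (Ψ⁻¹ * A * Ψ) * Ψ⁻¹ = A := by
    intro A
    calc _ = (Ψ * Ψ⁻¹) * A * (Ψ * Ψ⁻¹) := by simp only [Matrix.mul_assoc]
      _ = _ := by rw [i1, Matrix.one_mul, Matrix.mul_one]
  refine ⟨e, Ψ, hU, ?_, ?_, ?_⟩
  · intro Q hQ
    exact (key _).mp ((key2 Q).mp hQ)
  · intro Q _ Q' _ h
    have h3 := congrArg (fun A => Ψ⁻¹ * A * Ψ) h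
    dsimp only at h3
    rw [c3, c3] at h3
    exact (Matrix.reindex e e).injective h3
  · intro X hX
    have hx : Ψ * (Matrix.reindex e e ((Matrix.reindex e e).symm (Ψ⁻¹ * X * Ψ))) * Ψ⁻¹ = X := by
      rw [Equiv.apply_symm_apply, c4]
    refine ⟨(Matrix.reindex e e).symm (Ψ⁻¹ * X * Ψ), ?_, hx⟩
    refine (key2 _).mpr ((key _).mpr ?_)
    rw [hx]
    exact hX

end
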